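/- arXiv:2008.10296 — 8 statements merged into one kernel-verified Lean document; each statement's English description precedes it below -/
import Mathlib

section
/- With ε = μ + S·g and Z = εᵀAε + bᵀε + c as in the context and A symmetric, the variance of Z, i.e. ∫ (Z − E[Z])² with respect to the law of g, equals 2·tr((S A S)²) + bᵀΣb + 4·bᵀΣAμ + 4·μᵀAΣAμ, where Σ = S². -/
open MeasureTheory ProbabilityTheory Matrix

section StdGaussian

variable {ι : Type*} [Fintype ι]

local notation "γ" => Measure.pi fun _ : ι => gaussianReal 0 1

lemma mgf_dotProduct_pi_gaussianReal (t : ι → ℝ) :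
    mgf (fun g : ι → ℝ => t ⬝ᵥ g) γ = fun s => Real.exp (t ⬝ᵥ t * s ^ 2 / 2) := by
  have hind : iIndepFun (fun (i : ι) (g : ι → ℝ) => t i * g i) γ :=
    iIndepFun_pi (X := fun i x => t i * x) (fun i => by fun_prop)
  have hsum : (fun g : ι → ℝ => t ⬝ᵥ g) = ∑ i, fun g : ι → ℝ => t i * g i := by
    ext g
    simp [dotProduct]
  ext s
  rw [hsum, hind.mgf_sum (fun i => by fun_prop)]
  have hcoord (i : ι) : mgf (fun g : ι → ℝ => t i * g i) γ s =
      Real.exp (t i * t i * s ^ 2 / 2) := by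
    have hmap : Measure.map (fun g : ι → ℝ => g i) γ = gaussianReal 0 1 :=
      (measurePreserving_eval _ i).map_eq
    rw [mgf_const_mul, mgf_gaussianReal hmap]
    congr 1
    simp
    ring
  simp_rw [hcoord]
  rw [← Real.exp_sum]
  simp [dotProduct, Finset.sum_mul, Finset.sum_div]

lemma integrableExpSet_dotProduct_pi_gaussianReal (t : ι → ℝ) :
    integrableExpSet (fun g : ι → ℝ => t ⬝ᵥ g) γ = Set.univ := by
  ext s
  simp only [integrableExpSet, Set.mem_ofPred_eq, Set.mem_univ, iff_true]
  by_contra h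
  have h0 := mgf_undef h
  rw [mgf_dotProduct_pi_gaussianReal] at h0
  exact (Real.exp_pos _).ne' h0

lemma integrable_dotProduct_pow_pi_gaussianReal (t : ι → ℝ) (k : ℕ) :
    Integrable (fun g : ι → ℝ => (t ⬝ᵥ g) ^ k) γ :=
  integrable_pow_of_mem_interior_integrableExpSet
    (by simp [integrableExpSet_dotProduct_pi_gaussianReal]) k

lemma integral_dotProduct_pow_pi_gaussianReal (t : ι → ℝ) (k : ℕ) :
    ∫ g : ι → ℝ, (t ⬝ᵥ g) ^ k ∂γ =
      iteratedDeriv k (fun s => Real.exp (t ⬝ᵥ t * s ^ 2 / 2)) 0 := by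
  rw [← mgf_dotProduct_pi_gaussianReal, iteratedDeriv_mgf_zero
    (by simp [integrableExpSet_dotProduct_pi_gaussianReal])]
  rfl

lemma deriv_mul_exp_half_sq {p p' : ℝ → ℝ} (hp : ∀ s, HasDerivAt p (p' s) s) (v : ℝ) :
    deriv (fun s => p s * Real.exp (v * s ^ 2 / 2)) =
      fun s => (p' s + p s * (v * s)) * Real.exp (v * s ^ 2 / 2) := by
  ext s
  have h : HasDerivAt (fun s : ℝ => v * s ^ 2 / 2) (v * s) s :=
    (((hasDerivAt_pow 2 s).const_mul v).div_const 2).congr_deriv (by push_cast; ring)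
  rw [((hp s).fun_mul h.exp).deriv]
  ring

lemma iteratedDeriv_exp_half_sq (v : ℝ) :
    iteratedDeriv 1 (fun s => Real.exp (v * s ^ 2 / 2)) 0 = 0 ∧
    iteratedDeriv 2 (fun s => Real.exp (v * s ^ 2 / 2)) 0 = v ∧
    iteratedDeriv 3 (fun s => Real.exp (v * s ^ 2 / 2)) 0 = 0 ∧
    iteratedDeriv 4 (fun s => Real.exp (v * s ^ 2 / 2)) 0 = 3 * v ^ 2 := by
  have h1 : iteratedDeriv 1 (fun s => Real.exp (v * s ^ 2 / 2)) =
      fun s => (v * s) * Real.exp (v * s ^ 2 / 2) := by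
    have := deriv_mul_exp_half_sq (p := fun _ => 1) (p' := fun _ => 0)
      (fun s => hasDerivAt_const s 1) v
    simpa [iteratedDeriv_one] using this
  have h2 : iteratedDeriv 2 (fun s => Real.exp (v * s ^ 2 / 2)) =
      fun s => (v + v ^ 2 * s ^ 2) * Real.exp (v * s ^ 2 / 2) := by
    rw [iteratedDeriv_succ, h1, deriv_mul_exp_half_sq (p' := fun _ => v)
      (fun s => by simpa using (hasDerivAt_id s).const_mul v)]
    ext s
    ring
  have h3 : iteratedDeriv 3 (fun s => Real.exp (v * s ^ 2 / 2)) =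
      fun s => (3 * v ^ 2 * s + v ^ 3 * s ^ 3) * Real.exp (v * s ^ 2 / 2) := by
    rw [iteratedDeriv_succ, h2, deriv_mul_exp_half_sq (p' := fun s => v ^ 2 * (2 * s))
      (fun s => by simpa using ((hasDerivAt_pow 2 s).const_mul (v ^ 2)).const_add v)]
    ext s
    ring
  have h4 : iteratedDeriv 4 (fun s => Real.exp (v * s ^ 2 / 2)) =
      fun s => (3 * v ^ 2 + 6 * v ^ 3 * s ^ 2 + v ^ 4 * s ^ 4) * Real.exp (v * s ^ 2 / 2) := by
    rw [iteratedDeriv_succ, h3, deriv_mul_exp_half_sq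
      (p' := fun s => 3 * v ^ 2 + v ^ 3 * (3 * s ^ 2))
      (fun s => by
        simpa using ((hasDerivAt_id s).const_mul (3 * v ^ 2)).fun_add
          ((hasDerivAt_pow 3 s).const_mul (v ^ 3)))]
    ext s
    ring
  simp [h1, h2, h3, h4]

lemma integrable_integral_dotProduct_pi_gaussianReal (t : ι → ℝ) :
    Integrable (fun g : ι → ℝ => t ⬝ᵥ g) γ ∧ ∫ g : ι → ℝ, t ⬝ᵥ g ∂γ = 0 := by
  constructor
  · simpa using integrable_dotProduct_pow_pi_gaussianReal t 1
  · have h := integral_dotProduct_pow_pi_gaussianReal t 1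
    rw [(iteratedDeriv_exp_half_sq _).1] at h
    simpa using h

lemma integrable_integral_dotProduct_mul_pi_gaussianReal (t u : ι → ℝ) :
    Integrable (fun g : ι → ℝ => (t ⬝ᵥ g) * (u ⬝ᵥ g)) γ ∧
      ∫ g : ι → ℝ, (t ⬝ᵥ g) * (u ⬝ᵥ g) ∂γ = t ⬝ᵥ u := by
  have hI (x : ι → ℝ) := integrable_dotProduct_pow_pi_gaussianReal x 2
  have hE (x : ι → ℝ) : ∫ g : ι → ℝ, (x ⬝ᵥ g) ^ 2 ∂γ = x ⬝ᵥ x :=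
    (integral_dotProduct_pow_pi_gaussianReal x 2).trans (iteratedDeriv_exp_half_sq _).2.1
  have hpol : (fun g : ι → ℝ => (t ⬝ᵥ g) * (u ⬝ᵥ g)) =
      fun g => (1 / 4) * (((t + u) ⬝ᵥ g) ^ 2 - ((t - u) ⬝ᵥ g) ^ 2) := by
    ext g
    simp only [add_dotProduct, sub_dotProduct]
    ring
  rw [hpol]
  refine ⟨((hI _).sub' (hI _)).const_mul _, ?_⟩
  rw [integral_const_mul, integral_sub (hI _) (hI _), hE, hE]
  simp only [add_dotProduct, sub_dotProduct, dotProduct_add, dotProduct_sub, dotProduct_comm u t]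
  ring

lemma integrable_integral_dotProduct_mul_mul_pi_gaussianReal (t u v : ι → ℝ) :
    Integrable (fun g : ι → ℝ => (t ⬝ᵥ g) * (u ⬝ᵥ g) * (v ⬝ᵥ g)) γ ∧
      ∫ g : ι → ℝ, (t ⬝ᵥ g) * (u ⬝ᵥ g) * (v ⬝ᵥ g) ∂γ = 0 := by
  have hI (x : ι → ℝ) := integrable_dotProduct_pow_pi_gaussianReal x 3
  have hE (x : ι → ℝ) : ∫ g : ι → ℝ, (x ⬝ᵥ g) ^ 3 ∂γ = 0 :=
    (integral_dotProduct_pow_pi_gaussianReal x 3).trans (iteratedDeriv_exp_half_sq _).2.2.1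
  have hpol : (fun g : ι → ℝ => (t ⬝ᵥ g) * (u ⬝ᵥ g) * (v ⬝ᵥ g)) =
      fun g => (1 / 24) * ((((t + u + v) ⬝ᵥ g) ^ 3 - ((t + u - v) ⬝ᵥ g) ^ 3) -
        (((t - u + v) ⬝ᵥ g) ^ 3 - ((t - u - v) ⬝ᵥ g) ^ 3)) := by
    ext g
    simp only [add_dotProduct, sub_dotProduct]
    ring
  rw [hpol]
  refine ⟨(((hI _).sub' (hI _)).sub ((hI _).sub' (hI _))).const_mul _, ?_⟩
  rw [integral_const_mul, integral_sub ((hI _).sub' (hI _)) ((hI _).sub' (hI _)),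
    integral_sub (hI _) (hI _), integral_sub (hI _) (hI _)]
  simp only [hE, sub_self, mul_zero]

/-- **Isserlis' theorem** for four linear forms in a standard Gaussian vector. -/
lemma integrable_integral_dotProduct_mul_mul_mul_pi_gaussianReal (t u v w : ι → ℝ) :
    Integrable (fun g : ι → ℝ => ((t ⬝ᵥ g) * (u ⬝ᵥ g)) * ((v ⬝ᵥ g) * (w ⬝ᵥ g))) γ ∧
      ∫ g : ι → ℝ, ((t ⬝ᵥ g) * (u ⬝ᵥ g)) * ((v ⬝ᵥ g) * (w ⬝ᵥ g)) ∂γ =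
        (t ⬝ᵥ u) * (v ⬝ᵥ w) + (t ⬝ᵥ v) * (u ⬝ᵥ w) + (t ⬝ᵥ w) * (u ⬝ᵥ v) := by
  have hI (x : ι → ℝ) := integrable_dotProduct_pow_pi_gaussianReal x 4
  have hE (x : ι → ℝ) : ∫ g : ι → ℝ, (x ⬝ᵥ g) ^ 4 ∂γ = 3 * (x ⬝ᵥ x) ^ 2 :=
    (integral_dotProduct_pow_pi_gaussianReal x 4).trans (iteratedDeriv_exp_half_sq _).2.2.2
  have hI2 (x y : ι → ℝ) := (hI x).sub' (hI y)
  have hI4 (x y z p : ι → ℝ) := (hI2 x y).sub' (hI2 z p)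
  have hpol : (fun g : ι → ℝ => ((t ⬝ᵥ g) * (u ⬝ᵥ g)) * ((v ⬝ᵥ g) * (w ⬝ᵥ g))) =
      fun g => (1 / 192) *
        (((((t + u + v + w) ⬝ᵥ g) ^ 4 - ((t + u + v - w) ⬝ᵥ g) ^ 4) -
          (((t + u - v + w) ⬝ᵥ g) ^ 4 - ((t + u - v - w) ⬝ᵥ g) ^ 4)) -
        ((((t - u + v + w) ⬝ᵥ g) ^ 4 - ((t - u + v - w) ⬝ᵥ g) ^ 4) -
          (((t - u - v + w) ⬝ᵥ g) ^ 4 - ((t - u - v - w) ⬝ᵥ g) ^ 4))) := by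
    ext g
    simp only [add_dotProduct, sub_dotProduct]
    ring
  rw [hpol]
  refine ⟨((hI4 _ _ _ _).sub (hI4 _ _ _ _)).const_mul _, ?_⟩
  rw [integral_const_mul, integral_sub (hI4 _ _ _ _) (hI4 _ _ _ _),
    integral_sub (hI2 _ _) (hI2 _ _), integral_sub (hI2 _ _) (hI2 _ _),
    integral_sub (hI _) (hI _), integral_sub (hI _) (hI _),
    integral_sub (hI _) (hI _), integral_sub (hI _) (hI _)]
  simp only [hE]
  simp only [add_dotProduct, sub_dotProduct, dotProduct_add, dotProduct_sub,
    dotProduct_comm u t, dotProduct_comm v t, dotProduct_comm w t, dotProduct_comm v u,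
    dotProduct_comm w u, dotProduct_comm w v]
  ring

lemma dotProduct_mulVec_self_eq_sum [DecidableEq ι] (M : Matrix ι ι ℝ) (g : ι → ℝ) :
    g ⬝ᵥ M *ᵥ g = ∑ i, (Pi.single i 1 ⬝ᵥ g) * (M.row i ⬝ᵥ g) := by
  simp only [single_one_dotProduct]
  rfl

lemma integrable_integral_quadraticForm_pi_gaussianReal (M : Matrix ι ι ℝ) :
    Integrable (fun g : ι → ℝ => g ⬝ᵥ M *ᵥ g) γ ∧
      ∫ g : ι → ℝ, g ⬝ᵥ M *ᵥ g ∂γ = M.trace := by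
  classical
  simp_rw [dotProduct_mulVec_self_eq_sum]
  have h (i : ι) := integrable_integral_dotProduct_mul_pi_gaussianReal (Pi.single i 1) (M.row i)
  refine ⟨integrable_finsetSum _ fun i _ => (h i).1, ?_⟩
  rw [integral_finsetSum _ fun i _ => (h i).1]
  simp_rw [(h _).2, single_one_dotProduct]
  rfl

lemma integrable_integral_quadraticForm_mul_dotProduct_pi_gaussianReal
    (M : Matrix ι ι ℝ) (a : ι → ℝ) :
    Integrable (fun g : ι → ℝ => (g ⬝ᵥ M *ᵥ g) * (a ⬝ᵥ g)) γ ∧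
      ∫ g : ι → ℝ, (g ⬝ᵥ M *ᵥ g) * (a ⬝ᵥ g) ∂γ = 0 := by
  classical
  simp_rw [dotProduct_mulVec_self_eq_sum, Finset.sum_mul]
  have h (i : ι) :=
    integrable_integral_dotProduct_mul_mul_pi_gaussianReal (Pi.single i 1) (M.row i) a
  refine ⟨integrable_finsetSum _ fun i _ => (h i).1, ?_⟩
  rw [integral_finsetSum _ fun i _ => (h i).1]
  simp only [(h _).2, Finset.sum_const_zero]

lemma integrable_integral_quadraticForm_sq_pi_gaussianReal {M : Matrix ι ι ℝ} (hM : M.IsSymm) :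
    Integrable (fun g : ι → ℝ => (g ⬝ᵥ M *ᵥ g) ^ 2) γ ∧
      ∫ g : ι → ℝ, (g ⬝ᵥ M *ᵥ g) ^ 2 ∂γ = M.trace ^ 2 + 2 * (M * M).trace := by
  classical
  simp_rw [dotProduct_mulVec_self_eq_sum, sq, Finset.sum_mul_sum]
  have h (i j : ι) := integrable_integral_dotProduct_mul_mul_mul_pi_gaussianReal
    (Pi.single i 1) (M.row i) (Pi.single j 1) (M.row j)
  have hi (i : ι) := integrable_finsetSum Finset.univ fun j _ => (h i j).1
  refine ⟨integrable_finsetSum _ fun i _ => hi i, ?_⟩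
  rw [integral_finsetSum _ fun i _ => hi i]
  have hij (i : ι) := integral_finsetSum Finset.univ fun j _ => (h i j).1
  simp_rw [hij, (h _ _).2]
  have hrow (i j : ι) : M.row i ⬝ᵥ M.row j = (M * M) i j := by
    rw [mul_apply]
    exact Finset.sum_congr rfl fun k _ => by rw [row_apply, row_apply, hM.apply k j]
  have hsq : ∑ i, ∑ j, M j i * M i j = (M * M).trace := by
    simp only [trace, diag_apply, mul_apply]
    exact Finset.sum_comm
  simp only [single_dotProduct, dotProduct_single, row_apply, one_mul, mul_one, hrow,
    Finset.sum_add_distrib,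
    Pi.single_apply, ite_mul, zero_mul, Finset.sum_ite_eq', Finset.mem_univ,
    if_true, hsq]
  rw [← Finset.sum_mul_sum]
  simp only [trace, diag_apply]
  ring

/-- The variance of `gᵀ M g + aᵀ g + d` for `g` a standard Gaussian vector. -/
lemma centralMoment_two_quadraticForm_pi_gaussianReal {M : Matrix ι ι ℝ} (hM : M.IsSymm)
    (a : ι → ℝ) (d : ℝ) :
    ∫ g : ι → ℝ, ((g ⬝ᵥ M *ᵥ g + a ⬝ᵥ g + d) -
        ∫ g' : ι → ℝ, (g' ⬝ᵥ M *ᵥ g' + a ⬝ᵥ g' + d) ∂γ) ^ 2 ∂γ =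
      2 * (M * M).trace + a ⬝ᵥ a := by
  obtain ⟨iL, eL⟩ := integrable_integral_dotProduct_pi_gaussianReal a
  obtain ⟨iLL, eLL⟩ := integrable_integral_dotProduct_mul_pi_gaussianReal a a
  obtain ⟨iQ, eQ⟩ := integrable_integral_quadraticForm_pi_gaussianReal M
  obtain ⟨iQL, eQL⟩ := integrable_integral_quadraticForm_mul_dotProduct_pi_gaussianReal M a
  obtain ⟨iQQ, eQQ⟩ := integrable_integral_quadraticForm_sq_pi_gaussianReal hM
  have hmean : ∫ g : ι → ℝ, (g ⬝ᵥ M *ᵥ g + a ⬝ᵥ g + d) ∂γ = M.trace + d := by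
    rw [integral_add (iQ.fun_add iL) (integrable_const d), integral_add iQ iL, eQ, eL]
    simp
  rw [hmean]
  have hexp (g : ι → ℝ) : ((g ⬝ᵥ M *ᵥ g + a ⬝ᵥ g + d) - (M.trace + d)) ^ 2 =
      (g ⬝ᵥ M *ᵥ g) ^ 2 + 2 * ((g ⬝ᵥ M *ᵥ g) * (a ⬝ᵥ g)) + (a ⬝ᵥ g) * (a ⬝ᵥ g)
        + (-2 * M.trace) * (g ⬝ᵥ M *ᵥ g) + (-2 * M.trace) * (a ⬝ᵥ g) + M.trace ^ 2 := by
    ring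
  simp_rw [hexp]
  have i1 := iQQ.fun_add (iQL.const_mul 2)
  have i2 := i1.fun_add iLL
  have i3 := i2.fun_add (iQ.const_mul (-2 * M.trace))
  have i4 := i3.fun_add (iL.const_mul (-2 * M.trace))
  rw [integral_add i4 (integrable_const _), integral_add i3 (iL.const_mul _),
    integral_add i2 (iQ.const_mul _), integral_add i1 iLL, integral_add iQQ (iQL.const_mul _),
    integral_const_mul, integral_const_mul, integral_const_mul, eQQ, eQL, eLL, eQ, eL]
  simp
  ring

end StdGaussian

/-- Variance of a Gaussian quadratic form: with `ε = μ + S g`, `g` a standard normal vector,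
`Σ = S²`, `A` symmetric, and `Z = εᵀAε + bᵀε + c`, we have
`Var[Z] = 2 tr((SAS)²) + bᵀΣb + 4 bᵀΣAμ + 4 μᵀAΣAμ`. -/
theorem stmt2 (n : ℕ) (hn : 1 ≤ n) (S A : Matrix (Fin n) (Fin n) ℝ)
    (hS : S.IsSymm) (hA : A.IsSymm) (μ b : Fin n → ℝ) (c : ℝ)
    (Sig : Matrix (Fin n) (Fin n) ℝ) (hSig : Sig = S * S)
    (Z : (Fin n → ℝ) → ℝ)
    (hZ : ∀ g, Z g = (μ + S.mulVec g) ⬝ᵥ A.mulVec (μ + S.mulVec g)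
        + b ⬝ᵥ (μ + S.mulVec g) + c) :
    (∫ g, (Z g - ∫ g', Z g' ∂(Measure.pi fun _ : Fin n => gaussianReal 0 1)) ^ 2
        ∂(Measure.pi fun _ : Fin n => gaussianReal 0 1))
      = 2 * ((S * A * S) ^ 2).trace + b ⬝ᵥ Sig.mulVec b
        + 4 * (b ⬝ᵥ (Sig * A).mulVec μ) + 4 * (μ ⬝ᵥ (A * Sig * A).mulVec μ) := by
  have hdot (x y : Fin n → ℝ) : x ⬝ᵥ S *ᵥ y = (S *ᵥ x) ⬝ᵥ y := by
    rw [dotProduct_mulVec, ← mulVec_transpose, hS.eq]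
  have hdotA (x y : Fin n → ℝ) : x ⬝ᵥ A *ᵥ y = (A *ᵥ x) ⬝ᵥ y := by
    rw [dotProduct_mulVec, ← mulVec_transpose, hA.eq]
  have hM : (S * A * S).IsSymm := by
    simp [IsSymm, transpose_mul, hS.eq, hA.eq, Matrix.mul_assoc]
  have hZ' : Z = fun g => g ⬝ᵥ (S * A * S) *ᵥ g + (S *ᵥ ((2 : ℝ) • A *ᵥ μ + b)) ⬝ᵥ g
      + (μ ⬝ᵥ A *ᵥ μ + b ⬝ᵥ μ + c) := by
    ext g
    rw [hZ, ← hdot _ g, ← mulVec_mulVec, ← mulVec_mulVec, hdot g]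
    generalize S *ᵥ g = x
    simp only [mulVec_add, add_dotProduct, dotProduct_add, smul_dotProduct, smul_eq_mul,
      hdotA μ x, dotProduct_comm x (A *ᵥ μ)]
    ring
  simp_rw [hZ']
  rw [centralMoment_two_quadraticForm_pi_gaussianReal hM, hSig, sq]
  have hcomm : (A *ᵥ μ) ⬝ᵥ S *ᵥ S *ᵥ b = b ⬝ᵥ S *ᵥ S *ᵥ A *ᵥ μ := by
    rw [hdot, hdot, dotProduct_comm]
  simp only [← mulVec_mulVec, mulVec_add, add_dotProduct, dotProduct_add, mulVec_smul,
    smul_dotProduct, dotProduct_smul, smul_eq_mul, ← hdot, hdotA μ, hcomm]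
  ring
end

section
/- With ε = μ + S·g and Z = εᵀAε + bᵀε + c as in the context and A symmetric, the third central moment of Z, i.e. ∫ (Z − E[Z])³ with respect to the law of g, equals 8·tr((S A S)³) + 6·bᵀΣAΣb + 24·bᵀΣAΣAμ + 24·μᵀAΣAΣAμ, where Σ = S². -/
open MeasureTheory ProbabilityTheory Matrix

open Polynomial in
/-- Successive derivatives of `exp (t ^ 2 / 2)` are polynomial multiples of it. -/
theorem iteratedDeriv_exp_sq_div_two (k : ℕ) :
    iteratedDeriv k (fun t : ℝ ↦ Real.exp (t ^ 2 / 2)) = fun t ↦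
      (((fun p : ℝ[X] ↦ derivative p + X * p)^[k] 1).eval t) * Real.exp (t ^ 2 / 2) := by
  induction k with
  | zero => simp
  | succ k ih =>
    rw [iteratedDeriv_succ, ih, Function.iterate_succ_apply']
    ext t
    have h : HasDerivAt (fun t : ℝ ↦ Real.exp (t ^ 2 / 2)) (Real.exp (t ^ 2 / 2) * t) t := by
      have h2 := ((hasDerivAt_pow 2 t).div_const 2).exp
      simpa using h2
    refine ((Polynomial.hasDerivAt _ t).fun_mul h).deriv.trans ?_
    simp only [eval_add, eval_mul, eval_X]
    ring

open Polynomial in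
theorem integral_pow_gaussianReal_zero_one (k : ℕ) :
    ∫ x, x ^ k ∂gaussianReal 0 1 =
      ((fun p : ℝ[X] ↦ derivative p + X * p)^[k] 1).eval 0 := by
  have h : iteratedDeriv k (mgf (fun x ↦ x) (gaussianReal 0 1)) 0 =
      ∫ x, x ^ k ∂gaussianReal 0 1 := by
    rw [iteratedDeriv_mgf_zero] <;> simp
  rw [← h, mgf_fun_id_gaussianReal]
  simp [iteratedDeriv_exp_sq_div_two]

theorem integrable_pow_gaussianReal (μ : ℝ) (v : NNReal) (k : ℕ) :
    Integrable (fun x ↦ x ^ k) (gaussianReal μ v) := by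
  have := (memLp_id_gaussianReal' (μ := μ) (v := v) k (by simp)).integrable_norm_pow'
  rw [← integrable_norm_iff (by fun_prop)]
  simpa using this

theorem integral_pow_two_to_six_gaussianReal_zero_one :
    ∫ x, x ^ 2 ∂gaussianReal 0 1 = 1 ∧ ∫ x, x ^ 3 ∂gaussianReal 0 1 = 0 ∧
    ∫ x, x ^ 4 ∂gaussianReal 0 1 = 3 ∧ ∫ x, x ^ 5 ∂gaussianReal 0 1 = 0 ∧
    ∫ x, x ^ 6 ∂gaussianReal 0 1 = 15 := by
  simp only [integral_pow_gaussianReal_zero_one]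
  norm_num [Function.iterate_succ_apply']

theorem integral_centered_quadratic_gaussianReal (a w : ℝ) :
    ∫ x, (a * (x ^ 2 - 1) + w * x) ∂gaussianReal 0 1 = 0 := by
  have hi := integrable_pow_gaussianReal 0 1
  have h1 : Integrable (fun x : ℝ ↦ x) (gaussianReal 0 1) := by simpa using hi 1
  have h2 : Integrable (fun x : ℝ ↦ x ^ 2 - 1) (gaussianReal 0 1) :=
    (hi 2).sub (integrable_const 1)
  rw [integral_add (h2.const_mul a) (h1.const_mul w), integral_const_mul,
    integral_const_mul, integral_sub (hi 2) (integrable_const 1),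
    integral_pow_two_to_six_gaussianReal_zero_one.1]
  simp

theorem centered_quadratic_pow_three (a w x : ℝ) :
    (a * (x ^ 2 - 1) + w * x) ^ 3 = ∑ k : Fin 7,
      ![-a ^ 3, 3 * a ^ 2 * w, 3 * a ^ 3 - 3 * a * w ^ 2, w ^ 3 - 6 * a ^ 2 * w,
        3 * a * w ^ 2 - 3 * a ^ 3, 3 * a ^ 2 * w, a ^ 3] k * x ^ (k : ℕ) := by
  simp [Fin.sum_univ_succ]
  ring

theorem memLp_three_centered_quadratic_gaussianReal (a w : ℝ) :
    MemLp (fun x ↦ a * (x ^ 2 - 1) + w * x) 3 (gaussianReal 0 1) := by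
  have h : Integrable (fun x ↦ (a * (x ^ 2 - 1) + w * x) ^ 3) (gaussianReal 0 1) := by
    simp_rw [centered_quadratic_pow_three]
    exact integrable_finsetSum _ fun k _ ↦ (integrable_pow_gaussianReal 0 1 k).const_mul _
  have h' := integrable_norm_rpow_iff (μ := gaussianReal 0 1)
    (f := fun x ↦ a * (x ^ 2 - 1) + w * x) (p := 3) (by fun_prop) (by simp) (by simp)
  rw [← h']
  simpa using h.norm

theorem integral_centered_quadratic_pow_three_gaussianReal (a w : ℝ) :
    ∫ x, (a * (x ^ 2 - 1) + w * x) ^ 3 ∂gaussianReal 0 1 = 8 * a ^ 3 + 6 * a * w ^ 2 := by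
  obtain ⟨h2, h3, h4, h5, h6⟩ := integral_pow_two_to_six_gaussianReal_zero_one
  simp_rw [centered_quadratic_pow_three]
  rw [integral_finsetSum _ fun (k : Fin 7) _ ↦ (integrable_pow_gaussianReal 0 1 k).const_mul _]
  simp_rw [integral_const_mul]
  have h0 : ∫ x : ℝ, x ^ 0 ∂gaussianReal 0 1 = 1 := by simp
  have h1 : ∫ x : ℝ, x ^ 1 ∂gaussianReal 0 1 = 0 := by simp
  rw [Fin.sum_univ_seven]
  dsimp only [Fin.isValue, Fin.coe_ofNat_eq_mod, Nat.reduceMod]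
  rw [h0, h1, h2, h3, h4, h5, h6]
  dsimp [Matrix.cons_val]
  ring

/-- The third moment is additive over independent centered random variables. -/
theorem integral_sum_pow_three_of_iIndepFun {Ω ι : Type*} [MeasurableSpace Ω] {P : Measure Ω}
    [IsProbabilityMeasure P] {X : ι → Ω → ℝ} (hX : iIndepFun X P) (hm : ∀ i, Measurable (X i))
    (hL : ∀ i, MemLp (X i) 3 P) (h0 : ∀ i, ∫ ω, X i ω ∂P = 0) (s : Finset ι) :
    ∫ ω, (∑ i ∈ s, X i ω) ^ 3 ∂P = ∑ i ∈ s, ∫ ω, X i ω ^ 3 ∂P := by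
  classical
  induction s using Finset.induction_on with
  | empty => simp
  | insert j s hj ih =>
    simp_rw [Finset.sum_insert hj]
    rw [← ih]
    set Y : Ω → ℝ := fun ω ↦ ∑ i ∈ s, X i ω with hY
    have hYm : Measurable Y := by fun_prop
    have hYL : MemLp Y 3 P := memLp_finsetSum s fun i _ ↦ hL i
    have hind : IndepFun Y (X j) P := by
      convert hX.indepFun_finsetSum_of_notMem hm hj using 1
      ext ω; simp [hY]
    have hpow {W : Ω → ℝ} (hW : MemLp W 3 P) {k : ℕ} (hk : k ≤ 3) :
        Integrable (fun ω ↦ W ω ^ k) P := by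
      have hW' : MemLp W k P := hW.mono_exponent (by exact_mod_cast hk)
      rw [← integrable_norm_iff (by have := hW.1; fun_prop)]
      simpa using hW'.integrable_norm_pow'
    have hcomp (k l : ℕ) : IndepFun (fun ω ↦ Y ω ^ k) (fun ω ↦ X j ω ^ l) P :=
      hind.comp (φ := fun x ↦ x ^ k) (ψ := fun x ↦ x ^ l) (by fun_prop) (by fun_prop)
    have hprod {k l : ℕ} (hk : k ≤ 3) (hl : l ≤ 3) :
        Integrable (fun ω ↦ Y ω ^ k * X j ω ^ l) P :=
      (hcomp k l).integrable_mul (hpow hYL hk) (hpow (hL j) hl)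
    have hint (k l : ℕ) : ∫ ω, Y ω ^ k * X j ω ^ l ∂P =
        (∫ ω, Y ω ^ k ∂P) * ∫ ω, X j ω ^ l ∂P :=
      (hcomp k l).integral_fun_mul_eq_mul_integral (by fun_prop)
        ((hm j).pow_const l).aestronglyMeasurable
    have hY0 : ∫ ω, Y ω ∂P = 0 := by
      rw [hY, integral_finsetSum _ fun i _ ↦ (hL i).integrable (by norm_num)]
      simp [h0]
    have key (ω : Ω) : (X j ω + Y ω) ^ 3 =
        X j ω ^ 3 + Y ω ^ 3 + 3 * (Y ω ^ 2 * X j ω ^ 1) + 3 * (Y ω ^ 1 * X j ω ^ 2) := by ring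
    have i1 : Integrable (fun ω ↦ X j ω ^ 3) P := hpow (hL j) le_rfl
    have i2 : Integrable (fun ω ↦ X j ω ^ 3 + Y ω ^ 3) P := i1.add (hpow hYL le_rfl)
    have j1 : Integrable (fun ω ↦ 3 * (Y ω ^ 2 * X j ω ^ 1)) P :=
      (hprod (by norm_num) (by norm_num)).const_mul 3
    have j2 : Integrable (fun ω ↦ 3 * (Y ω ^ 1 * X j ω ^ 2)) P :=
      (hprod (by norm_num) (by norm_num)).const_mul 3
    have i3 : Integrable (fun ω ↦ X j ω ^ 3 + Y ω ^ 3 + 3 * (Y ω ^ 2 * X j ω ^ 1)) P := i2.add j1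
    change ∫ ω, (X j ω + Y ω) ^ 3 ∂P = _
    simp_rw [key]
    rw [integral_add i3 j2, integral_add i2 j1, integral_add i1 (hpow hYL le_rfl),
      integral_const_mul, integral_const_mul, hint, hint]
    simp only [pow_one, h0, hY0]
    ring

/-- The standard Gaussian measure on `ι → ℝ` is invariant under the change to an
orthonormal eigenbasis of a symmetric matrix. -/
theorem measurePreserving_eigenvectorUnitary_mulVec {ι : Type*} [Fintype ι] [DecidableEq ι]
    {M : Matrix ι ι ℝ} (hM : M.IsHermitian) :
    MeasurePreserving (fun x : ι → ℝ ↦ (hM.eigenvectorUnitary : Matrix ι ι ℝ) *ᵥ x)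
      (Measure.pi fun _ ↦ gaussianReal 0 1) (Measure.pi fun _ ↦ gaussianReal 0 1) where
  measurable := by fun_prop
  map_eq := by
    have h := stdGaussian_eq_map_pi_orthonormalBasis hM.eigenvectorBasis
    rw [← map_pi_eq_stdGaussian] at h
    have h' := congrArg (Measure.map (WithLp.ofLp (p := 2) (V := ι → ℝ))) h
    rw [Measure.map_map (by fun_prop) (by fun_prop), Measure.map_map (by fun_prop) (by fun_prop)]
      at h'
    have e1 : WithLp.ofLp ∘ WithLp.toLp 2 = (id : (ι → ℝ) → ι → ℝ) := rfl
    rw [e1, Measure.map_id] at h'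
    convert h'.symm using 2
    ext x i
    simp [mulVec, dotProduct, mul_comm]

/-- Third central moment of a quadratic polynomial of a standard Gaussian vector. -/
theorem integral_quadratic_pow_three_pi_gaussianReal {ι : Type*} [Fintype ι] [DecidableEq ι]
    {M : Matrix ι ι ℝ} (hM : M.IsHermitian) (v : ι → ℝ) (k : ℝ) :
    ∫ g, (g ⬝ᵥ M *ᵥ g + v ⬝ᵥ g + k - ∫ g', (g' ⬝ᵥ M *ᵥ g' + v ⬝ᵥ g' + k)
        ∂(Measure.pi fun _ : ι ↦ gaussianReal 0 1)) ^ 3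
        ∂(Measure.pi fun _ : ι ↦ gaussianReal 0 1)
      = 8 * (M ^ 3).trace + 6 * (v ⬝ᵥ M *ᵥ v) := by
  set P := Measure.pi fun _ : ι ↦ gaussianReal 0 1 with hP
  set U := (hM.eigenvectorUnitary : Matrix ι ι ℝ)
  set a := hM.eigenvalues
  set w := Uᵀ *ᵥ v with hw
  have hUU : Uᵀ * U = 1 := by
    have := Unitary.coe_star_mul_self hM.eigenvectorUnitary
    rwa [star_eq_conjTranspose, conjTranspose_eq_transpose_of_trivial] at this
  have hspec : M = U * diagonal a * Uᵀ := by
    have := hM.spectral_theorem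
    rwa [Unitary.conjStarAlgAut_apply, star_eq_conjTranspose,
      conjTranspose_eq_transpose_of_trivial] at this
  have hdiag (x : ι → ℝ) : x ⬝ᵥ M *ᵥ x = ∑ i, a i * (Uᵀ *ᵥ x) i ^ 2 := by
    rw [hspec, ← mulVec_mulVec, ← mulVec_mulVec, dotProduct_mulVec, ← mulVec_transpose]
    simp only [dotProduct, mulVec_diagonal]
    exact Finset.sum_congr rfl fun i _ ↦ by ring
  have htrace : (M ^ 3).trace = ∑ i, a i ^ 3 := by
    have h3 : M ^ 3 = U * diagonal (a ^ 3) * Uᵀ := by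
      rw [← diagonal_pow, hspec]
      simp only [pow_succ, pow_zero, one_mul, mul_assoc]
      simp only [← mul_assoc Uᵀ U, hUU, one_mul]
    rw [h3, trace_mul_cycle, hUU, one_mul, trace_diagonal]
    rfl
  let X (i : ι) (x : ι → ℝ) : ℝ := a i * (x i ^ 2 - 1) + w i * x i
  have hq (x : ι → ℝ) : (U *ᵥ x) ⬝ᵥ M *ᵥ (U *ᵥ x) + v ⬝ᵥ (U *ᵥ x) + k =
      ∑ i, X i x + (∑ i, a i + k) := by
    rw [hdiag, mulVec_mulVec, hUU, one_mulVec, dotProduct_mulVec, ← mulVec_transpose, ← hw]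
    simp only [dotProduct, X, ← add_assoc, ← Finset.sum_add_distrib]
    congr 1
    exact Finset.sum_congr rfl fun i _ ↦ by ring
  have hrot (f : (ι → ℝ) → ℝ) (hf : Measurable f) : ∫ g, f g ∂P = ∫ x, f (U *ᵥ x) ∂P := by
    have h := measurePreserving_eigenvectorUnitary_mulVec hM
    conv_lhs => rw [hP, ← h.map_eq, integral_map h.measurable.aemeasurable
      hf.aestronglyMeasurable]
  have heval (i : ι) : MeasurePreserving (fun x : ι → ℝ ↦ x i) P (gaussianReal 0 1) :=
    measurePreserving_eval _ i
  have hXL (i : ι) : MemLp (X i) 3 P :=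
    (memLp_three_centered_quadratic_gaussianReal (a i) (w i)).comp_measurePreserving (heval i)
  have hX0 (i : ι) : ∫ x, X i x ∂P = 0 := by
    rw [← integral_centered_quadratic_gaussianReal (a i) (w i), ← (heval i).map_eq,
      integral_map (heval i).measurable.aemeasurable (by fun_prop)]
  have hX3 (i : ι) : ∫ x, X i x ^ 3 ∂P = 8 * a i ^ 3 + 6 * a i * w i ^ 2 := by
    rw [← integral_centered_quadratic_pow_three_gaussianReal (a i) (w i), ← (heval i).map_eq,
      integral_map (heval i).measurable.aemeasurable (by fun_prop)]
  have hXm (i : ι) : Measurable (X i) := by fun_prop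
  have hXI : iIndepFun X P :=
    iIndepFun_pi (X := fun i t ↦ a i * (t ^ 2 - 1) + w i * t) fun i ↦ by fun_prop
  have hmean : ∫ g, (g ⬝ᵥ M *ᵥ g + v ⬝ᵥ g + k) ∂P = ∑ i, a i + k := by
    have hi (i : ι) : Integrable (X i) P := (hXL i).integrable (by norm_num)
    rw [hrot _ (by simp only [dotProduct, mulVec]; fun_prop)]
    simp_rw [hq]
    rw [integral_add (integrable_finsetSum _ fun i _ ↦ hi i) (integrable_const _),
      integral_finsetSum _ fun i _ ↦ hi i]
    simp [hX0]
  rw [hmean, hrot _ (by simp only [dotProduct, mulVec]; fun_prop)]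
  simp_rw [hq, add_sub_cancel_right]
  rw [integral_sum_pow_three_of_iIndepFun hXI hXm hXL hX0, htrace, hdiag, Finset.mul_sum,
    Finset.mul_sum, ← Finset.sum_add_distrib]
  exact Finset.sum_congr rfl fun i _ ↦ by rw [hX3, hw, mul_assoc]


/-- Third central moment of a Gaussian quadratic form: with `ε = μ + S g`, `g` a standard normal
vector, `Σ = S²`, `A` symmetric, and `Z = εᵀAε + bᵀε + c`, we have
`E[(Z - E[Z])³] = 8 tr((SAS)³) + 6 bᵀΣAΣb + 24 bᵀΣAΣAμ + 24 μᵀAΣAΣAμ`. -/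
theorem stmt3 (n : ℕ) (hn : 1 ≤ n) (S A : Matrix (Fin n) (Fin n) ℝ)
    (hS : S.IsSymm) (hA : A.IsSymm) (μ b : Fin n → ℝ) (c : ℝ)
    (Sig : Matrix (Fin n) (Fin n) ℝ) (hSig : Sig = S * S)
    (Z : (Fin n → ℝ) → ℝ)
    (hZ : ∀ g, Z g = (μ + S.mulVec g) ⬝ᵥ A.mulVec (μ + S.mulVec g)
        + b ⬝ᵥ (μ + S.mulVec g) + c) :
    (∫ g, (Z g - ∫ g', Z g' ∂(Measure.pi fun _ : Fin n => gaussianReal 0 1)) ^ 3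
        ∂(Measure.pi fun _ : Fin n => gaussianReal 0 1))
      = 8 * ((S * A * S) ^ 3).trace + 6 * (b ⬝ᵥ (Sig * A * Sig).mulVec b)
        + 24 * (b ⬝ᵥ (Sig * A * Sig * A).mulVec μ)
        + 24 * (μ ⬝ᵥ (A * Sig * A * Sig * A).mulVec μ) := by
  subst hSig
  have hM : (S * A * S).IsHermitian := by
    simp [IsHermitian, conjTranspose_eq_transpose_of_trivial, transpose_mul, hS.eq, hA.eq,
      mul_assoc]
  have hsymm {B : Matrix (Fin n) (Fin n) ℝ} (hB : B.IsSymm) (x y : Fin n → ℝ) :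
      x ⬝ᵥ B *ᵥ y = (B *ᵥ x) ⬝ᵥ y := by
    rw [dotProduct_mulVec, ← mulVec_transpose, hB.eq]
  have hZ' (g : Fin n → ℝ) : Z g = g ⬝ᵥ (S * A * S) *ᵥ g
      + (S *ᵥ ((2 : ℝ) • A *ᵥ μ + b)) ⬝ᵥ g + (μ ⬝ᵥ A *ᵥ μ + b ⬝ᵥ μ + c) := by
    rw [hZ, ← hsymm hS]
    simp only [← mulVec_mulVec, mulVec_add, dotProduct_add, add_dotProduct, smul_dotProduct,
      smul_eq_mul, hsymm hS g]
    rw [← hsymm hA μ (S *ᵥ g), dotProduct_comm (S *ᵥ g) (A *ᵥ μ), ← hsymm hA μ]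
    ring
  simp_rw [hZ']
  rw [integral_quadratic_pow_three_pi_gaussianReal hM]
  have hv : (S *ᵥ ((2 : ℝ) • A *ᵥ μ + b)) ⬝ᵥ (S * A * S) *ᵥ (S *ᵥ ((2 : ℝ) • A *ᵥ μ + b)) =
      b ⬝ᵥ (S * S * A * (S * S)) *ᵥ b + 4 * (b ⬝ᵥ (S * S * A * (S * S) * A) *ᵥ μ)
        + 4 * (μ ⬝ᵥ (A * (S * S) * A * (S * S) * A) *ᵥ μ) := by
    have hQ : (S * S * A * (S * S)).IsSymm := by
      simp [IsSymm, transpose_mul, hS.eq, hA.eq, mul_assoc]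
    have e1 : b ⬝ᵥ (S * S * A * (S * S) * A) *ᵥ μ =
        b ⬝ᵥ (S * S * A * (S * S)) *ᵥ (A *ᵥ μ) := by rw [mulVec_mulVec]
    have e2 : μ ⬝ᵥ (A * (S * S) * A * (S * S) * A) *ᵥ μ =
        (A *ᵥ μ) ⬝ᵥ (S * S * A * (S * S)) *ᵥ (A *ᵥ μ) := by
      rw [← hsymm hA, mulVec_mulVec, mulVec_mulVec]
      simp only [mul_assoc]
    have e3 (u : Fin n → ℝ) : (S *ᵥ u) ⬝ᵥ (S * A * S) *ᵥ (S *ᵥ u) =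
        u ⬝ᵥ (S * S * A * (S * S)) *ᵥ u := by
      rw [← hsymm hS, mulVec_mulVec, mulVec_mulVec]
      simp only [mul_assoc]
    rw [e1, e2, e3]
    simp only [mulVec_add, mulVec_smul, dotProduct_add, add_dotProduct, smul_dotProduct,
      dotProduct_smul, smul_eq_mul]
    rw [hsymm hQ (A *ᵥ μ) b, dotProduct_comm _ b]
    ring
  rw [hv]
  ring
end

section
/- Let X be an n×d real matrix with rows X_1,…,X_n such that for every i the leave-one-out Gram matrix G_i = Σ_{p ≠ i} X_pᵀ X_p is positive definite. Define the n×n matrix P̃ by P̃_{ii} = −1 and P̃_{ij} = X_j G_i^{-1} X_iᵀ for j ≠ i, and the diagonal matrix D̃ with D̃_{ii} = ( X_i G_i^{-1} X_iᵀ + 1 )^{-1}. Then tr( P̃ᵀ D̃ P̃ ) = n. Consequently, for two n-column-compatible design matrices X_A and X_B (each with all leave-one-out Gram matrices positive definite) with associated matrices (P̃_A, D̃_A) and (P̃_B, D̃_B), tr( P̃_Aᵀ D̃_A P̃_A − P̃_Bᵀ D̃_B P̃_B ) = 0. -/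
open Matrix

/-- Leave-one-out Gram matrix of the rows of `X` with row `i` deleted. -/
noncomputable def looGram {n d : ℕ} (X : Matrix (Fin n) (Fin d) ℝ) (i : Fin n) :
    Matrix (Fin d) (Fin d) ℝ :=
  ∑ p ∈ Finset.univ.erase i, Matrix.vecMulVec (X p) (X p)

/-- The matrix `P̃` of LOO prediction weights, with `-1` on the diagonal. -/
noncomputable def looP {n d : ℕ} (X : Matrix (Fin n) (Fin d) ℝ) :
    Matrix (Fin n) (Fin n) ℝ :=
  fun i j => if i = j then -1 else X j ⬝ᵥ (looGram X i)⁻¹.mulVec (X i)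

/-- The diagonal matrix `D̃` with `D̃_{ii} = (X_i G_i⁻¹ X_iᵀ + 1)⁻¹`. -/
noncomputable def looD {n d : ℕ} (X : Matrix (Fin n) (Fin d) ℝ) :
    Matrix (Fin n) (Fin n) ℝ :=
  Matrix.diagonal fun i => (X i ⬝ᵥ (looGram X i)⁻¹.mulVec (X i) + 1)⁻¹

lemma dotProduct_looGram_mulVec {n d : ℕ} (X : Matrix (Fin n) (Fin d) ℝ) (i : Fin n)
    (w : Fin d → ℝ) :
    w ⬝ᵥ looGram X i *ᵥ w = ∑ j ∈ Finset.univ.erase i, (X j ⬝ᵥ w) ^ 2 := by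
  simp only [looGram, sum_mulVec, dotProduct_sum, vecMulVec_mulVec, op_smul_eq_smul,
    dotProduct_smul, smul_eq_mul]
  exact Finset.sum_congr rfl fun j _ => by rw [dotProduct_comm w, sq]

lemma sum_looP_sq {n d : ℕ} {X : Matrix (Fin n) (Fin d) ℝ} {i : Fin n}
    (h : (looGram X i).PosDef) :
    ∑ j, looP X i j ^ 2 = X i ⬝ᵥ (looGram X i)⁻¹ *ᵥ X i + 1 := by
  have hG : looGram X i *ᵥ (looGram X i)⁻¹ *ᵥ X i = X i := by
    rw [mulVec_mulVec, mul_nonsing_inv _ ((isUnit_iff_isUnit_det _).mp h.isUnit), one_mulVec]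
  have key := dotProduct_looGram_mulVec X i ((looGram X i)⁻¹ *ᵥ X i)
  rw [hG, dotProduct_comm] at key
  rw [key, ← Finset.sum_erase_add _ _ (Finset.mem_univ i)]
  congr 1
  · refine Finset.sum_congr rfl fun j hj => ?_
    simp [looP, (Finset.ne_of_mem_erase hj).symm]
  · simp [looP]

lemma trace_looP_looD_looP {n d : ℕ} {X : Matrix (Fin n) (Fin d) ℝ}
    (h : ∀ i, (looGram X i).PosDef) :
    ((looP X)ᵀ * looD X * looP X).trace = (n : ℝ) := by
  have hrow (i : Fin n) : (looP X * (looP X)ᵀ * looD X) i i = 1 := by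
    have hpos : 0 ≤ X i ⬝ᵥ (looGram X i)⁻¹ *ᵥ X i := by
      simpa using (h i).inv.posSemidef.dotProduct_mulVec_nonneg (X i)
    rw [looD, mul_diagonal, mul_apply]
    simp only [transpose_apply, ← sq]
    rw [sum_looP_sq (h i)]
    exact mul_inv_cancel₀ (by positivity)
  rw [trace_mul_comm, ← Matrix.mul_assoc]
  simp [trace, hrow]

/-- `tr(P̃ᵀ D̃ P̃) = n` for any design matrix with positive definite LOO Gram matrices;
consequently the quadratic-form matrix of the LOO-CV difference of two models is traceless. -/
theorem stmt8 (n dA dB : ℕ)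
    (XA : Matrix (Fin n) (Fin dA) ℝ) (XB : Matrix (Fin n) (Fin dB) ℝ)
    (hA : ∀ i, (looGram XA i).PosDef) (hB : ∀ i, (looGram XB i).PosDef) :
    ((looP XA)ᵀ * looD XA * looP XA).trace = (n : ℝ) ∧
    ((looP XB)ᵀ * looD XB * looP XB).trace = (n : ℝ) ∧
    ((looP XA)ᵀ * looD XA * looP XA - (looP XB)ᵀ * looD XB * looP XB).trace = 0 := by
  have h₁ := trace_looP_looD_looP hA
  have h₂ := trace_looP_looD_looP hB
  exact ⟨h₁, h₂, by rw [trace_sub, h₁, h₂, sub_self]⟩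
end

section
/- Let X be an n×d real matrix, let X_k be the n×d_k submatrix formed by a subset k of its columns with X_kᵀX_k positive definite, and let P = X_k (X_kᵀX_k)^{-1} X_kᵀ be the orthogonal projection onto the column space of X_k. Let τ > 0, β ∈ ℝ^d, μ⋆ ∈ ℝⁿ, σ⋆ ∈ ℝⁿ with σ⋆_i > 0 for all i, let D be the diagonal matrix with D_{ii} = (P_{ii} + 1)^{-1}, let ε ∈ ℝⁿ and y = Xβ + ε. Then Σ_{i=1}^n ∫_ℝ N(t; (Xβ)_i + μ⋆_i, σ⋆_i²) · ( −(t − (P y)_i)²/(2(1 + P_{ii})τ²) − (1/2)·log(2π(1 + P_{ii})τ²) ) dt = εᵀAε + bᵀε + c, where A = −(1/(2τ²)) P D P, b = −(1/τ²)( P D (P − I) X β − P D μ⋆ ), and c = −(1/(2τ²))( ((P − I)Xβ − μ⋆)ᵀ D ((P − I)Xβ − μ⋆) + σ⋆ᵀ D σ⋆ ) − (n/2)·log(2πτ²) + (1/2)·Σ_{i=1}^n log D_{ii}. -/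
open MeasureTheory Real Matrix

/-- The second moment of a real Gaussian about an arbitrary point. -/
lemma integral_sub_sq_gaussianReal (m : ℝ) (v : NNReal) (a : ℝ) :
    ∫ t, (t - a) ^ 2 ∂ProbabilityTheory.gaussianReal m v = v + (m - a) ^ 2 := by
  have hid : MemLp (fun t : ℝ ↦ t) 2 (ProbabilityTheory.gaussianReal m v) :=
    ProbabilityTheory.memLp_id_gaussianReal 2
  have hsub : MemLp (fun t : ℝ ↦ t - a) 2 (ProbabilityTheory.gaussianReal m v) :=
    hid.sub (memLp_const a)
  have hvar := ProbabilityTheory.variance_eq_sub hsub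
  have hmean : ∫ t, (t - a) ∂ProbabilityTheory.gaussianReal m v = m - a := by
    rw [integral_sub (hid.integrable (by norm_num)) (integrable_const a),
      ProbabilityTheory.integral_id_gaussianReal]
    simp
  rw [ProbabilityTheory.variance_sub_const hid.aestronglyMeasurable,
    ProbabilityTheory.variance_fun_id_gaussianReal, hmean] at hvar
  simp only [Pi.pow_apply] at hvar
  linarith

/-- The expectation of a shifted quadratic under a normal density. -/
lemma integral_gaussian_density_mul_quadratic (m a q r : ℝ) {s : ℝ} (hs : 0 < s) :
    ∫ t : ℝ, (2 * π * s ^ 2) ^ (-(1 : ℝ) / 2) * Real.exp (-(t - m) ^ 2 / (2 * s ^ 2)) *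
      (-(t - a) ^ 2 / q - r) = -(s ^ 2 + (m - a) ^ 2) / q - r := by
  let v : NNReal := ⟨s ^ 2, sq_nonneg s⟩
  have hv : v ≠ 0 := fun h ↦ (pow_pos hs 2).ne' (congrArg NNReal.toReal h)
  have hdens (t : ℝ) : (2 * π * s ^ 2) ^ (-(1 : ℝ) / 2) *
      Real.exp (-(t - m) ^ 2 / (2 * s ^ 2)) = ProbabilityTheory.gaussianPDFReal m v t := by
    rw [ProbabilityTheory.gaussianPDFReal, Real.sqrt_eq_rpow, ← Real.rpow_neg (by positivity),
      neg_div]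
    rfl
  have hint : Integrable (fun t : ℝ ↦ (t - a) ^ 2) (ProbabilityTheory.gaussianReal m v) :=
    ((ProbabilityTheory.memLp_id_gaussianReal 2).sub (memLp_const a)).integrable_sq
  have hcalc := ProbabilityTheory.integral_gaussianReal_eq_integral_smul (μ := m) hv
    (f := fun t ↦ -(t - a) ^ 2 / q - r)
  simp only [smul_eq_mul] at hcalc
  simp only [hdens]
  rw [← hcalc, integral_sub (hint.fun_neg.div_const q) (integrable_const r), integral_div,
    integral_neg, integral_sub_sq_gaussianReal, integral_const, probReal_univ, one_smul]
  rfl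

/-- Expansion of a diagonal quadratic form at a shifted image of a symmetric matrix. -/
lemma sum_mul_sq_add_mulVec {ι : Type*} [Fintype ι] [DecidableEq ι] {P : Matrix ι ι ℝ}
    (hP : Pᵀ = P) (δ w ε : ι → ℝ) :
    ∑ i, δ i * (w i + (P *ᵥ ε) i) ^ 2 =
      ε ⬝ᵥ (P * diagonal δ * P) *ᵥ ε + 2 * (((P * diagonal δ) *ᵥ w) ⬝ᵥ ε) +
        w ⬝ᵥ diagonal δ *ᵥ w := by
  have hmove (u : ι → ℝ) : (P *ᵥ u) ⬝ᵥ ε = u ⬝ᵥ P *ᵥ ε := by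
    rw [dotProduct_mulVec, ← mulVec_transpose, hP]
  rw [dotProduct_comm ε]
  simp only [← mulVec_mulVec, hmove]
  simp only [dotProduct, mulVec_diagonal, Finset.mul_sum, ← Finset.sum_add_distrib]
  exact Finset.sum_congr rfl fun i _ ↦ by ring

/-- elpd as a quadratic form in the residual vector (elpd part of Lemma 1): the expected log
pointwise predictive density of a Bayesian normal linear regression submodel equals
`εᵀAε + bᵀε + c` with explicit `A`, `b`, `c`. -/
theorem stmt9 (n d dk : ℕ) (X : Matrix (Fin n) (Fin d) ℝ)
    (κ : Fin dk → Fin d) (hκ : Function.Injective κ)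
    (Xk : Matrix (Fin n) (Fin dk) ℝ) (hXk : Xk = X.submatrix id κ)
    (hpd : (Xkᵀ * Xk).PosDef)
    (P : Matrix (Fin n) (Fin n) ℝ) (hP : P = Xk * (Xkᵀ * Xk)⁻¹ * Xkᵀ)
    (D : Matrix (Fin n) (Fin n) ℝ)
    (hD : D = Matrix.diagonal fun i => (P i i + 1)⁻¹)
    (τ : ℝ) (hτ : 0 < τ) (β : Fin d → ℝ) (μs σs ε : Fin n → ℝ)
    (hσs : ∀ i, 0 < σs i)
    (y : Fin n → ℝ) (hy : y = X.mulVec β + ε)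
    (A : Matrix (Fin n) (Fin n) ℝ)
    (hA : A = -(1 / (2 * τ ^ 2)) • (P * D * P))
    (b : Fin n → ℝ)
    (hb : b = -(1 / τ ^ 2) •
        ((P * D * (P - 1)).mulVec (X.mulVec β) - (P * D).mulVec μs))
    (c : ℝ)
    (hc : c = -(1 / (2 * τ ^ 2)) *
        (((P - 1).mulVec (X.mulVec β) - μs) ⬝ᵥ
            D.mulVec ((P - 1).mulVec (X.mulVec β) - μs)
          + σs ⬝ᵥ D.mulVec σs)
        - ((n : ℝ) / 2) * Real.log (2 * π * τ ^ 2)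
        + (1 / 2) * ∑ i, Real.log (D i i)) :
    (∑ i, ∫ t : ℝ,
        (2 * π * (σs i) ^ 2) ^ (-(1 : ℝ) / 2) *
          Real.exp (-(t - ((X.mulVec β) i + μs i)) ^ 2 / (2 * (σs i) ^ 2)) *
          (-(t - (P.mulVec y) i) ^ 2 / (2 * (1 + P i i) * τ ^ 2)
            - (1 / 2) * Real.log (2 * π * (1 + P i i) * τ ^ 2)))
      = ε ⬝ᵥ A.mulVec ε + b ⬝ᵥ ε + c := by
  have hPsd : P.PosSemidef := by
    have h := hpd.inv.posSemidef.mul_mul_conjTranspose_same Xk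
    rwa [conjTranspose_eq_transpose_of_trivial, ← hP] at h
  have hPsymm : Pᵀ = P := by
    rw [← conjTranspose_eq_transpose_of_trivial]
    exact hPsd.isHermitian
  have hdiag (i : Fin n) : 0 < P i i + 1 := by
    have := hPsd.diag_nonneg (i := i)
    linarith
  set δ : Fin n → ℝ := fun i ↦ (P i i + 1)⁻¹ with hδ
  set g := X *ᵥ β with hg
  set w := (P - 1) *ᵥ g - μs with hw
  have hresid (i : Fin n) : g i + μs i - (P *ᵥ y) i = -(w i + (P *ᵥ ε) i) := by
    simp only [hw, hy, mulVec_add, sub_mulVec, one_mulVec, Pi.add_apply, Pi.sub_apply]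
    ring
  have hlog (i : Fin n) : Real.log (2 * π * (1 + P i i) * τ ^ 2) =
      Real.log (2 * π * τ ^ 2) - Real.log (δ i) := by
    rw [hδ, Real.log_inv, sub_neg_eq_add, ← Real.log_mul (by positivity) (hdiag i).ne']
    congr 1
    ring
  have hterm (i : Fin n) :
      -((σs i) ^ 2 + (g i + μs i - (P *ᵥ y) i) ^ 2) / (2 * (1 + P i i) * τ ^ 2) -
          (1 / 2) * Real.log (2 * π * (1 + P i i) * τ ^ 2) =
        -(1 / (2 * τ ^ 2)) * (δ i * (w i + (P *ᵥ ε) i) ^ 2 + σs i * (δ i * σs i)) -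
          (1 / 2) * Real.log (2 * π * τ ^ 2) + (1 / 2) * Real.log (δ i) := by
    have h1 : 1 + P i i ≠ 0 := by linarith [hdiag i]
    rw [hresid, hlog]
    simp only [hδ, add_comm (P i i) 1]
    field_simp
    ring
  have hb' : b = -(1 / τ ^ 2) • ((P * D) *ᵥ w) := by
    rw [hb, hw, mulVec_sub, mulVec_mulVec g]
  simp_rw [fun i ↦ integral_gaussian_density_mul_quadratic (g i + μs i) ((P *ᵥ y) i)
    (2 * (1 + P i i) * τ ^ 2) ((1 / 2) * Real.log (2 * π * (1 + P i i) * τ ^ 2)) (hσs i), hterm]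
  have hσD : σs ⬝ᵥ D *ᵥ σs = ∑ i, σs i * (δ i * σs i) := by
    simp only [hD, dotProduct, mulVec_diagonal]
  have hDlog : ∑ i, Real.log (D i i) = ∑ i, Real.log (δ i) := by
    simp only [hD, diagonal_apply_eq]
  rw [Finset.sum_add_distrib, Finset.sum_sub_distrib, ← Finset.mul_sum, ← Finset.mul_sum,
    ← Finset.mul_sum, Finset.sum_add_distrib, sum_mul_sq_add_mulVec hPsymm, hc, hb', hA, hσD, hDlog, ← hD,
    smul_mulVec, dotProduct_smul, smul_dotProduct]
  simp only [smul_eq_mul, Finset.sum_const, Finset.card_univ, Fintype.card_fin, nsmul_eq_mul]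
  field_simp
  ring
end

section
/- Let n ≥ 1, let Σ be a symmetric positive definite n×n real matrix with symmetric positive definite square root S (S² = Σ), let A be a symmetric n×n real matrix, μ ∈ ℝⁿ, and let q₁, q₀ ∈ ℝⁿ with q₁ ≠ 0. For r ∈ ℝ set b(r) = r·q₁ + q₀ and define m̄₂(r) = 2·tr((S A S)²) + b(r)ᵀΣb(r) + 4·b(r)ᵀΣAμ + 4·μᵀAΣAμ and m̄₃(r) = 8·tr((S A S)³) + 6·b(r)ᵀΣAΣb(r) + 24·b(r)ᵀΣAΣAμ + 24·μᵀAΣAΣAμ. Then m̄₃(r)/m̄₂(r)^{3/2} tends to 0 as r → +∞ and as r → −∞. -/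
open Matrix Filter

/-- A real quadratic function divided by the square tends to its leading coefficient along any
filter on which `|r| → ∞`. -/
theorem tendsto_quadratic_div_sq {l : Filter ℝ} (hl : Tendsto (fun r : ℝ => |r|) l atTop)
    (a b c : ℝ) :
    Tendsto (fun r : ℝ => (a * r ^ 2 + b * r + c) / r ^ 2) l (nhds a) := by
  have hinv : Tendsto (fun r : ℝ => r⁻¹) l (nhds 0) := by
    rw [tendsto_zero_iff_abs_tendsto_zero]
    simpa [Function.comp_def, abs_inv] using tendsto_inv_atTop_zero.comp hl
  have hlim : Tendsto (fun r : ℝ => a + b * r⁻¹ + c * r⁻¹ ^ 2) l (nhds a) := by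
    simpa using (tendsto_const_nhds (x := a)).add (hinv.const_mul b) |>.add
      ((hinv.pow 2).const_mul c)
  refine hlim.congr' ?_
  filter_upwards [hl.eventually_gt_atTop 0] with r hr
  have hr0 : r ≠ 0 := abs_pos.mp hr
  field_simp

/-- A real quadratic function divided by the power `3/2` of a quadratic function with positive
leading coefficient tends to `0` along any filter on which `|r| → ∞`. -/
theorem tendsto_quadratic_div_quadratic_rpow {l : Filter ℝ}
    (hl : Tendsto (fun r : ℝ => |r|) l atTop) {a : ℝ} (ha : 0 < a) (b c d e f : ℝ) :
    Tendsto (fun r : ℝ => (d * r ^ 2 + e * r + f) / (a * r ^ 2 + b * r + c) ^ ((3 : ℝ) / 2))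
      l (nhds 0) := by
  have hsq : Tendsto (fun r : ℝ => r ^ 2) l atTop := by
    simpa [Function.comp_def] using (tendsto_pow_atTop (α := ℝ) two_ne_zero).comp hl
  have hP := tendsto_quadratic_div_sq hl d e f
  have hQ := tendsto_quadratic_div_sq hl a b c
  have hpos := hl.eventually_gt_atTop 0
  have hQtop : Tendsto (fun r : ℝ => a * r ^ 2 + b * r + c) l atTop := by
    refine (hQ.pos_mul_atTop ha hsq).congr' ?_
    filter_upwards [hpos] with r hr
    have hr0 : r ≠ 0 := abs_pos.mp hr
    exact div_mul_cancel₀ _ (pow_ne_zero 2 hr0)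
  have hhalf := (tendsto_rpow_neg_atTop (y := (1 : ℝ) / 2) (by norm_num)).comp hQtop
  have hmul := (hP.div hQ ha.ne').mul hhalf
  rw [mul_zero] at hmul
  refine hmul.congr' ?_
  filter_upwards [hpos, hQtop.eventually_gt_atTop 0] with r hr hQr
  have hr0 : r ^ 2 ≠ 0 := pow_ne_zero 2 (abs_pos.mp hr)
  have hsplit : (a * r ^ 2 + b * r + c) ^ ((3 : ℝ) / 2)
      = (a * r ^ 2 + b * r + c) * (a * r ^ 2 + b * r + c) ^ ((1 : ℝ) / 2) := by
    rw [← Real.rpow_one_add' hQr.le (by norm_num)]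
    norm_num
  simp only [Pi.div_apply, Function.comp_apply]
  rw [div_div_div_cancel_right₀ hr0, Real.rpow_neg hQr.le, hsplit, ← div_eq_mul_inv, div_div]

/-- A quadratic form along an affine line is a quadratic function. -/
theorem dotProduct_mulVec_affine {ι : Type*} [Fintype ι] (M : Matrix ι ι ℝ) (p q : ι → ℝ)
    (r : ℝ) :
    (r • p + q) ⬝ᵥ M.mulVec (r • p + q) = (p ⬝ᵥ M.mulVec p) * r ^ 2
      + (p ⬝ᵥ M.mulVec q + q ⬝ᵥ M.mulVec p) * r + q ⬝ᵥ M.mulVec q := by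
  simp only [mulVec_add, mulVec_smul, add_dotProduct, dotProduct_add, smul_dotProduct,
    dotProduct_smul, smul_eq_mul]
  ring


/-- The skewness of the LOO-CV error vanishes as the magnitude of the non-shared covariate
effects grows to `±∞`: with `b(r) = r q₁ + q₀`, `q₁ ≠ 0`, the ratio `m̄₃(r)/m̄₂(r)^{3/2}`
tends to `0` as `r → +∞` and as `r → -∞`. -/
theorem stmt11 (n : ℕ) (hn : 1 ≤ n)
    (Sig S A : Matrix (Fin n) (Fin n) ℝ)
    (hSigSymm : Sig.IsSymm) (hSigPD : Sig.PosDef)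
    (hSSymm : S.IsSymm) (hSPD : S.PosDef) (hSq : S * S = Sig)
    (hASymm : A.IsSymm)
    (μ q1 q0 : Fin n → ℝ) (hq1 : q1 ≠ 0)
    (b : ℝ → Fin n → ℝ) (hb : ∀ r, b r = r • q1 + q0)
    (m2 m3 : ℝ → ℝ)
    (hm2 : ∀ r, m2 r = 2 * ((S * A * S) ^ 2).trace + b r ⬝ᵥ Sig.mulVec (b r)
        + 4 * (b r ⬝ᵥ (Sig * A).mulVec μ) + 4 * (μ ⬝ᵥ (A * Sig * A).mulVec μ))
    (hm3 : ∀ r, m3 r = 8 * ((S * A * S) ^ 3).trace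
        + 6 * (b r ⬝ᵥ (Sig * A * Sig).mulVec (b r))
        + 24 * (b r ⬝ᵥ (Sig * A * Sig * A).mulVec μ)
        + 24 * (μ ⬝ᵥ (A * Sig * A * Sig * A).mulVec μ)) :
    Tendsto (fun r => m3 r / m2 r ^ ((3 : ℝ) / 2)) atTop (nhds 0) ∧
    Tendsto (fun r => m3 r / m2 r ^ ((3 : ℝ) / 2)) atBot (nhds 0) := by
  have ha : 0 < q1 ⬝ᵥ Sig.mulVec q1 := by
    simpa using hSigPD.dotProduct_mulVec_pos hq1
  have key : ∀ l : Filter ℝ, Tendsto (fun r : ℝ => |r|) l atTop →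
      Tendsto (fun r => m3 r / m2 r ^ ((3 : ℝ) / 2)) l (nhds 0) := by
    intro l hl
    refine (tendsto_quadratic_div_quadratic_rpow hl ha
      (q1 ⬝ᵥ Sig.mulVec q0 + q0 ⬝ᵥ Sig.mulVec q1 + 4 * (q1 ⬝ᵥ (Sig * A).mulVec μ))
      (2 * ((S * A * S) ^ 2).trace + q0 ⬝ᵥ Sig.mulVec q0
        + 4 * (q0 ⬝ᵥ (Sig * A).mulVec μ) + 4 * (μ ⬝ᵥ (A * Sig * A).mulVec μ))
      (6 * (q1 ⬝ᵥ (Sig * A * Sig).mulVec q1))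
      (6 * (q1 ⬝ᵥ (Sig * A * Sig).mulVec q0 + q0 ⬝ᵥ (Sig * A * Sig).mulVec q1)
        + 24 * (q1 ⬝ᵥ (Sig * A * Sig * A).mulVec μ))
      (8 * ((S * A * S) ^ 3).trace + 6 * (q0 ⬝ᵥ (Sig * A * Sig).mulVec q0)
        + 24 * (q0 ⬝ᵥ (Sig * A * Sig * A).mulVec μ)
        + 24 * (μ ⬝ᵥ (A * Sig * A * Sig * A).mulVec μ))).congr fun r => ?_
    rw [hm2, hm3, hb, dotProduct_mulVec_affine, dotProduct_mulVec_affine]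
    simp only [add_dotProduct, smul_dotProduct, smul_eq_mul]
    congr 1
    · ring
    · congr 1
      ring
  exact ⟨key _ tendsto_abs_atTop_atTop, key _ tendsto_abs_atBot_atTop⟩
end

section
/- Let n ≥ 1, let A be a symmetric n×n real matrix with A ≠ 0, and let b, μ ∈ ℝⁿ. For σ > 0 define m̄₂(σ) = 2·σ⁴·tr(A²) + σ²·‖b + 2Aμ‖² and m̄₃(σ) = 8·σ⁶·tr(A³) + 6·σ⁴·(b + 2Aμ)ᵀ A (b + 2Aμ). Then m̄₃(σ)/m̄₂(σ)^{3/2} tends to 2^{3/2}·tr(A³)/tr(A²)^{3/2} as σ → ∞. -/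
open Matrix Filter

theorem Matrix.IsSymm.trace_sq_pos {ι : Type*} [Fintype ι] [DecidableEq ι] {A : Matrix ι ι ℝ}
    (hA : A.IsSymm) (hA0 : A ≠ 0) : 0 < (A ^ 2).trace := by
  have hsq : (A ^ 2).trace = (Aᴴ * A).trace := by
    rw [conjTranspose_eq_transpose_of_trivial, hA.eq, sq]
  rw [hsq]
  exact (posSemidef_conjTranspose_mul_self A).trace_nonneg.lt_of_ne'
    (mt trace_conjTranspose_mul_self_eq_zero_iff.1 hA0)

theorem tendsto_quartic_skewness {p q r s : ℝ} (hp : 0 < p) (hq : 0 ≤ q) :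
    Tendsto (fun σ : ℝ => (r * σ ^ 6 + s * σ ^ 4) / (p * σ ^ 4 + q * σ ^ 2) ^ ((3 : ℝ) / 2))
      atTop (nhds (r / p ^ ((3 : ℝ) / 2))) := by
  have hinv : Tendsto (fun σ : ℝ => (σ ^ 2)⁻¹) atTop (nhds 0) :=
    (tendsto_pow_atTop two_ne_zero).inv_tendsto_atTop
  have hnum : Tendsto (fun σ : ℝ => r + s * (σ ^ 2)⁻¹) atTop (nhds r) := by
    simpa using (hinv.const_mul s).const_add r
  have hden : Tendsto (fun σ : ℝ => p + q * (σ ^ 2)⁻¹) atTop (nhds p) := by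
    simpa using (hinv.const_mul q).const_add p
  refine (hnum.div (hden.rpow_const (Or.inl hp.ne'))
    (Real.rpow_pos_of_pos hp _).ne').congr' ?_
  filter_upwards [eventually_gt_atTop 0] with σ hσ
  have hpow : (σ ^ 4) ^ ((3 : ℝ) / 2) = σ ^ 6 := by
    rw [← Real.rpow_natCast, ← Real.rpow_mul hσ.le, ← Real.rpow_natCast]
    norm_num
  have hfactor : p * σ ^ 4 + q * σ ^ 2 = σ ^ 4 * (p + q * (σ ^ 2)⁻¹) := by
    field_simp
  have hnumFactor : r * σ ^ 6 + s * σ ^ 4 = σ ^ 6 * (r + s * (σ ^ 2)⁻¹) := by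
    field_simp
  rw [hfactor, hnumFactor, Real.mul_rpow (by positivity) (by positivity), hpow]
  exact (mul_div_mul_left _ _ (by positivity)).symm

/-- Proposition 4: as the true residual standard deviation `σ → ∞`, the skewness
`m̄₃(σ)/m̄₂(σ)^{3/2}` of the Gaussian quadratic form converges to
`2^{3/2} tr(A³)/tr(A²)^{3/2}`. -/
theorem stmt14 (n : ℕ) (hn : 1 ≤ n)
    (A : Matrix (Fin n) (Fin n) ℝ) (hASymm : A.IsSymm) (hA0 : A ≠ 0)
    (b μ : Fin n → ℝ)
    (m2 m3 : ℝ → ℝ)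
    (hm2 : ∀ σ : ℝ, 0 < σ → m2 σ = 2 * σ ^ 4 * (A ^ 2).trace
        + σ ^ 2 * ((b + (2 : ℝ) • A.mulVec μ) ⬝ᵥ (b + (2 : ℝ) • A.mulVec μ)))
    (hm3 : ∀ σ : ℝ, 0 < σ → m3 σ = 8 * σ ^ 6 * (A ^ 3).trace
        + 6 * σ ^ 4 * ((b + (2 : ℝ) • A.mulVec μ) ⬝ᵥ A.mulVec (b + (2 : ℝ) • A.mulVec μ))) :
    Tendsto (fun σ => m3 σ / m2 σ ^ ((3 : ℝ) / 2)) atTop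
      (nhds ((2 : ℝ) ^ ((3 : ℝ) / 2) * (A ^ 3).trace / (A ^ 2).trace ^ ((3 : ℝ) / 2))) := by
  set v := b + (2 : ℝ) • A.mulVec μ
  have hT : 0 < (A ^ 2).trace := hASymm.trace_sq_pos hA0
  have hv : 0 ≤ v ⬝ᵥ v := Finset.sum_nonneg fun i _ => mul_self_nonneg (v i)
  have hlim : 8 * (A ^ 3).trace / (2 * (A ^ 2).trace) ^ ((3 : ℝ) / 2)
      = (2 : ℝ) ^ ((3 : ℝ) / 2) * (A ^ 3).trace / (A ^ 2).trace ^ ((3 : ℝ) / 2) := by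
    have h8 : (8 : ℝ) = 2 ^ ((3 : ℝ) / 2) * 2 ^ ((3 : ℝ) / 2) := by
      rw [← Real.rpow_add two_pos]
      norm_num
    rw [Real.mul_rpow two_pos.le hT.le, h8, mul_assoc]
    exact mul_div_mul_left _ _ (Real.rpow_pos_of_pos two_pos _).ne'
  rw [← hlim]
  refine (tendsto_quartic_skewness (s := 6 * (v ⬝ᵥ A.mulVec v))
    (mul_pos two_pos hT) hv).congr' ?_
  filter_upwards [eventually_gt_atTop 0] with σ hσ
  rw [hm2 σ hσ, hm3 σ hσ]
  ring_nf
end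

section
/- Fix real numbers β₁, m⋆, s⋆ > 0 and τ > 0, and for integers n ≥ 3 define r(n) = ( −(n²/(2(n+1)))·β₁² − (n/(n+1))·β₁·m⋆ − (n/((n+2)(n+1)))·m⋆² + τ²·(n/2)·log((n+2)/(n+1)) ) / √( (n²(n² + 2n + 2)/(2(n+1)²(n+2)²))·s⋆⁴ ). Then: if β₁ = 0, r(n) tends to τ²/(√2·s⋆²) as n → ∞; and if β₁ ≠ 0, r(n) tends to −∞ as n → ∞. -/
open Filter

/-- The scaled variance ratio tends to `s ^ 4 / 2`, and its square root to `s ^ 2 / √2`. -/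
lemma tendsto_sqrt_variance_ratio (s : ℝ) :
    Tendsto (fun n : ℕ => Real.sqrt (((n : ℝ) ^ 2 * ((n : ℝ) ^ 2 + 2 * (n : ℝ) + 2)
      / (2 * ((n : ℝ) + 1) ^ 2 * ((n : ℝ) + 2) ^ 2)) * s ^ 4)) atTop
      (nhds (s ^ 2 / Real.sqrt 2)) := by
  have ha : Tendsto (fun n : ℕ => (n : ℝ) / ((n : ℝ) + 1)) atTop (nhds 1) :=
    tendsto_natCast_div_add_atTop (1 : ℝ)
  have hu : Tendsto (fun n : ℕ => ((n : ℝ) + 2)⁻¹) atTop (nhds 0) :=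
    (tendsto_atTop_add_const_right _ _ tendsto_natCast_atTop_atTop).inv_tendsto_atTop
  have hlim := ((((ha.pow 2).mul (((hu.const_mul 2).const_sub 1).add
    ((hu.pow 2).const_mul 2))).mul_const (1 / 2)).mul_const (s ^ 4)).sqrt
  have hval : s ^ 2 / Real.sqrt 2 =
      Real.sqrt (1 ^ 2 * (1 - 2 * 0 + 2 * 0 ^ 2) * (1 / 2) * s ^ 4) := by
    rw [show (1 ^ 2 * (1 - 2 * 0 + 2 * 0 ^ 2) * (1 / 2) * s ^ 4 : ℝ) = (s ^ 2) ^ 2 / 2 by ring,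
      Real.sqrt_div (sq_nonneg _), Real.sqrt_sq (sq_nonneg s)]
  rw [hval]
  refine hlim.congr fun n => ?_
  congr 2
  field_simp
  ring

lemma tendsto_natCast_mul_log_succ_ratio :
    Tendsto (fun n : ℕ => (n : ℝ) * Real.log (((n : ℝ) + 2) / ((n : ℝ) + 1))) atTop
      (nhds 1) := by
  have hx : Tendsto (fun n : ℕ => (n : ℝ) + 1) atTop atTop :=
    tendsto_atTop_add_const_right _ _ tendsto_natCast_atTop_atTop
  have hlim := (tendsto_natCast_div_add_atTop (1 : ℝ)).mul
    ((Real.tendsto_mul_log_one_add_div_atTop 1).comp hx)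
  rw [one_mul] at hlim
  refine hlim.congr fun n => ?_
  have hn : (n : ℝ) + 1 ≠ 0 := by positivity
  have hlog : 1 + 1 / ((n : ℝ) + 1) = ((n : ℝ) + 2) / ((n : ℝ) + 1) := by
    field_simp
    ring
  simp only [Function.comp_apply, hlog]
  field_simp

/-- The part of the mean that stays bounded converges. -/
lemma tendsto_bounded_mean (β m τ : ℝ) :
    Tendsto (fun n : ℕ => -(((n : ℝ) / ((n : ℝ) + 1)) * β * m)
        - ((n : ℝ) / (((n : ℝ) + 2) * ((n : ℝ) + 1))) * m ^ 2
        + τ ^ 2 * ((n : ℝ) / 2) * Real.log (((n : ℝ) + 2) / ((n : ℝ) + 1))) atTop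
      (nhds (-(β * m) + τ ^ 2 / 2)) := by
  have ha : Tendsto (fun n : ℕ => (n : ℝ) / ((n : ℝ) + 1)) atTop (nhds 1) :=
    tendsto_natCast_div_add_atTop (1 : ℝ)
  have hu : Tendsto (fun n : ℕ => ((n : ℝ) + 2)⁻¹) atTop (nhds 0) :=
    (tendsto_atTop_add_const_right _ _ tendsto_natCast_atTop_atTop).inv_tendsto_atTop
  have hlim := ((((ha.mul_const β).mul_const m).neg).sub ((ha.mul hu).mul_const (m ^ 2))).add
    (tendsto_natCast_mul_log_succ_ratio.const_mul (τ ^ 2 / 2))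
  convert hlim using 2
  · field_simp
  · ring

/-- Asymptotic mean-to-standard-deviation ratio of the elpd difference in the one-covariate
case (Proposition 5): if `β₁ = 0` it converges to `τ²/(√2 s⋆²)`, and if `β₁ ≠ 0` it tends
to `-∞`. -/
theorem stmt17 (β1 ms ss τ : ℝ) (hss : 0 < ss) (hτ : 0 < τ)
    (r : ℕ → ℝ)
    (hr : ∀ n : ℕ, 3 ≤ n → r n =
      (-((n : ℝ) ^ 2 / (2 * ((n : ℝ) + 1))) * β1 ^ 2
        - ((n : ℝ) / ((n : ℝ) + 1)) * β1 * ms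
        - ((n : ℝ) / (((n : ℝ) + 2) * ((n : ℝ) + 1))) * ms ^ 2
        + τ ^ 2 * ((n : ℝ) / 2) * Real.log (((n : ℝ) + 2) / ((n : ℝ) + 1)))
      / Real.sqrt (((n : ℝ) ^ 2 * ((n : ℝ) ^ 2 + 2 * (n : ℝ) + 2)
          / (2 * ((n : ℝ) + 1) ^ 2 * ((n : ℝ) + 2) ^ 2)) * ss ^ 4)) :
    (β1 = 0 → Tendsto r atTop (nhds (τ ^ 2 / (Real.sqrt 2 * ss ^ 2)))) ∧
    (β1 ≠ 0 → Tendsto r atTop atBot) := by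
  have hD := tendsto_sqrt_variance_ratio ss
  have hB := tendsto_bounded_mean β1 ms τ
  have h2 : 0 < Real.sqrt 2 := by positivity
  have hpos : 0 < ss ^ 2 / Real.sqrt 2 := by positivity
  refine ⟨fun h0 => ?_, fun h0 => ?_⟩
  · have hlim := hB.div hD hpos.ne'
    have hval : τ ^ 2 / (Real.sqrt 2 * ss ^ 2) =
        (-(β1 * ms) + τ ^ 2 / 2) / (ss ^ 2 / Real.sqrt 2) := by
      rw [h0]
      field_simp
      rw [Real.sq_sqrt zero_le_two]
      ring
    rw [hval]
    refine hlim.congr' ?_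
    filter_upwards [eventually_ge_atTop 3] with n hn
    rw [hr n hn, Pi.div_apply, h0]
    congr 1
    ring
  · have hmain : Tendsto (fun n : ℕ => (n : ℝ) *
        (-((n : ℝ) / ((n : ℝ) + 1) * (β1 ^ 2 / 2)))) atTop atBot := by
      refine tendsto_natCast_atTop_atTop.atTop_mul_neg ?_
        (((tendsto_natCast_div_add_atTop (1 : ℝ)).mul_const (β1 ^ 2 / 2)).neg)
      have : 0 < β1 ^ 2 := by positivity
      linarith
    have hlim := (hmain.atBot_add hB).atBot_mul_pos (inv_pos.2 hpos) (hD.inv₀ hpos.ne')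
    refine hlim.congr' ?_
    filter_upwards [eventually_ge_atTop 3] with n hn
    rw [hr n hn, div_eq_mul_inv _ (Real.sqrt _)]
    congr 1
    field_simp
    ring
end

section
/- Fix real numbers β₁, m⋆, s⋆ > 0 and τ > 0, and for integers n ≥ 3 define the numerator N(n) = −(n²/((n+1)(n−1)))·β₁² − (2n/((n+1)(n−1)))·β₁·m⋆ + (n/((n+2)(n+1)))·m⋆² + τ²·(n/2)·log( (n+1)(n−1)/((n+2)(n−2)) ) and the denominator D(n) = √( (n³/(n−1)²)·β₁²·s⋆² + (2n²/(n−1)²)·β₁·m⋆·s⋆² + (n/((n−1)(n−2)))·m⋆²·s⋆² + (n³(4n³ + 9n² + 5n − 6)/(2(n+2)²(n+1)²(n−1)(n−2)))·s⋆⁴ ). Then N(n)/D(n) tends to 0 as n → ∞. -/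
open Filter

/-- A sequence that is eventually a continuous function of `1 / n` converges to the value of that
function at `0`. -/
lemma tendsto_of_eq_comp_inv {f : ℕ → ℝ} {g : ℝ → ℝ} {a : ℝ} (hg : ContinuousAt g 0)
    (ha : g 0 = a) (h : ∀ n : ℕ, 3 ≤ n → f n = g (n : ℝ)⁻¹) : Tendsto f atTop (nhds a) := by
  have hlim : Tendsto (fun n : ℕ => g (n : ℝ)⁻¹) atTop (nhds a) :=
    ha ▸ hg.tendsto.comp tendsto_inv_atTop_nhds_zero_nat
  refine hlim.congr' ?_
  filter_upwards [eventually_ge_atTop 3] with n hn using (h n hn).symm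

lemma tendsto_sq_div_add_one_mul_sub_one :
    Tendsto (fun n : ℕ => (n : ℝ) ^ 2 / (((n : ℝ) + 1) * ((n : ℝ) - 1))) atTop (nhds 1) := by
  refine tendsto_of_eq_comp_inv (g := fun t => 1 / ((1 + t) * (1 - t))) ?_ (by norm_num) ?_
  · exact ContinuousAt.div (by fun_prop) (by fun_prop) (by norm_num)
  · intro n hn
    have h3 : (3 : ℝ) ≤ n := by exact_mod_cast hn
    have h0 : (n : ℝ) ≠ 0 := by linarith
    have h1 : (n : ℝ) - 1 ≠ 0 := by linarith
    field_simp

lemma tendsto_two_mul_div_add_one_mul_sub_one :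
    Tendsto (fun n : ℕ => 2 * (n : ℝ) / (((n : ℝ) + 1) * ((n : ℝ) - 1))) atTop (nhds 0) := by
  refine tendsto_of_eq_comp_inv (g := fun t => 2 * t / ((1 + t) * (1 - t))) ?_ (by norm_num) ?_
  · exact ContinuousAt.div (by fun_prop) (by fun_prop) (by norm_num)
  · intro n hn
    have h3 : (3 : ℝ) ≤ n := by exact_mod_cast hn
    have h0 : (n : ℝ) ≠ 0 := by linarith
    have h1 : (n : ℝ) - 1 ≠ 0 := by linarith
    field_simp

lemma tendsto_div_add_two_mul_add_one :
    Tendsto (fun n : ℕ => (n : ℝ) / (((n : ℝ) + 2) * ((n : ℝ) + 1))) atTop (nhds 0) := by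
  refine tendsto_of_eq_comp_inv (g := fun t => t / ((1 + 2 * t) * (1 + t))) ?_ (by norm_num) ?_
  · exact ContinuousAt.div (by fun_prop) (by fun_prop) (by norm_num)
  · intro n hn
    have h3 : (3 : ℝ) ≤ n := by exact_mod_cast hn
    have h0 : (n : ℝ) ≠ 0 := by linarith
    field_simp

lemma tendsto_half_mul_log_ratio :
    Tendsto (fun n : ℕ => (n : ℝ) / 2 *
      Real.log (((n : ℝ) + 1) * ((n : ℝ) - 1) / (((n : ℝ) + 2) * ((n : ℝ) - 2))))
      atTop (nhds 0) := by
  have hup : Tendsto (fun n : ℕ => (n : ℝ) / 2 * (3 / (((n : ℝ) + 2) * ((n : ℝ) - 2))))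
      atTop (nhds 0) := by
    refine tendsto_of_eq_comp_inv (g := fun t => 3 * t / (2 * ((1 + 2 * t) * (1 - 2 * t)))) ?_
      (by norm_num) ?_
    · exact ContinuousAt.div (by fun_prop) (by fun_prop) (by norm_num)
    · intro n hn
      have h3 : (3 : ℝ) ≤ n := by exact_mod_cast hn
      have h0 : (n : ℝ) ≠ 0 := by linarith
      have h2 : (n : ℝ) - 2 ≠ 0 := by linarith
      field_simp
  refine tendsto_of_tendsto_of_tendsto_of_le_of_le' tendsto_const_nhds hup ?_ ?_
  · filter_upwards [eventually_ge_atTop 3] with n hn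
    have h3 : (3 : ℝ) ≤ n := by exact_mod_cast hn
    have hpos : 0 < ((n : ℝ) + 2) * ((n : ℝ) - 2) := mul_pos (by linarith) (by linarith)
    refine mul_nonneg (by linarith) (Real.log_nonneg ?_)
    rw [one_le_div hpos]
    linarith
  · filter_upwards [eventually_ge_atTop 3] with n hn
    have h3 : (3 : ℝ) ≤ n := by exact_mod_cast hn
    have hpos : 0 < ((n : ℝ) + 2) * ((n : ℝ) - 2) := mul_pos (by linarith) (by linarith)
    have hnum : 0 < ((n : ℝ) + 1) * ((n : ℝ) - 1) := mul_pos (by linarith) (by linarith)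
    refine mul_le_mul_of_nonneg_left ?_ (by linarith)
    refine (Real.log_le_sub_one_of_pos (div_pos hnum hpos)).trans_eq ?_
    rw [div_sub_one hpos.ne']
    ring

lemma tendsto_cube_div_sub_one_sq :
    Tendsto (fun n : ℕ => (n : ℝ) ^ 3 / ((n : ℝ) - 1) ^ 2) atTop atTop := by
  refine tendsto_atTop_mono' _ ?_ tendsto_natCast_atTop_atTop
  filter_upwards [eventually_ge_atTop 3] with n hn
  have h3 : (3 : ℝ) ≤ n := by exact_mod_cast hn
  rw [le_div_iff₀ (pow_pos (by linarith) 2)]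
  nlinarith

lemma tendsto_two_mul_sq_div_sub_one_sq :
    Tendsto (fun n : ℕ => 2 * (n : ℝ) ^ 2 / ((n : ℝ) - 1) ^ 2) atTop (nhds 2) := by
  refine tendsto_of_eq_comp_inv (g := fun t => 2 / (1 - t) ^ 2) ?_ (by norm_num) ?_
  · exact ContinuousAt.div (by fun_prop) (by fun_prop) (by norm_num)
  · intro n hn
    have h3 : (3 : ℝ) ≤ n := by exact_mod_cast hn
    have h0 : (n : ℝ) ≠ 0 := by linarith
    have h1 : (n : ℝ) - 1 ≠ 0 := by linarith
    field_simp

lemma tendsto_div_sub_one_mul_sub_two :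
    Tendsto (fun n : ℕ => (n : ℝ) / (((n : ℝ) - 1) * ((n : ℝ) - 2))) atTop (nhds 0) := by
  refine tendsto_of_eq_comp_inv (g := fun t => t / ((1 - t) * (1 - 2 * t))) ?_ (by norm_num) ?_
  · exact ContinuousAt.div (by fun_prop) (by fun_prop) (by norm_num)
  · intro n hn
    have h3 : (3 : ℝ) ≤ n := by exact_mod_cast hn
    have h0 : (n : ℝ) ≠ 0 := by linarith
    have h1 : (n : ℝ) - 1 ≠ 0 := by linarith
    have h2 : (n : ℝ) - 2 ≠ 0 := by linarith
    field_simp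

lemma tendsto_residual_variance_coeff :
    Tendsto (fun n : ℕ => (n : ℝ) ^ 3 * (4 * (n : ℝ) ^ 3 + 9 * (n : ℝ) ^ 2 + 5 * (n : ℝ) - 6)
      / (2 * ((n : ℝ) + 2) ^ 2 * ((n : ℝ) + 1) ^ 2 * ((n : ℝ) - 1) * ((n : ℝ) - 2)))
      atTop (nhds 2) := by
  refine tendsto_of_eq_comp_inv (g := fun t => (4 + 9 * t + 5 * t ^ 2 - 6 * t ^ 3) /
    (2 * (1 + 2 * t) ^ 2 * (1 + t) ^ 2 * (1 - t) * (1 - 2 * t))) ?_ (by norm_num) ?_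
  · exact ContinuousAt.div (by fun_prop) (by fun_prop) (by norm_num)
  · intro n hn
    have h3 : (3 : ℝ) ≤ n := by exact_mod_cast hn
    have h0 : (n : ℝ) ≠ 0 := by linarith
    have h1 : (n : ℝ) - 1 ≠ 0 := by linarith
    have h2 : (n : ℝ) - 2 ≠ 0 := by linarith
    field_simp

/-- The relative bias of the LOO-CV estimator vanishes asymptotically in the one-covariate
case (Proposition 5): the ratio of the mean to the standard deviation of the LOO-CV error
tends to `0` as `n → ∞`, for every value of `β₁`. -/
theorem stmt18 (β1 ms ss τ : ℝ) (hss : 0 < ss) (hτ : 0 < τ)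
    (N D : ℕ → ℝ)
    (hN : ∀ n : ℕ, 3 ≤ n → N n =
      -((n : ℝ) ^ 2 / (((n : ℝ) + 1) * ((n : ℝ) - 1))) * β1 ^ 2
        - (2 * (n : ℝ) / (((n : ℝ) + 1) * ((n : ℝ) - 1))) * β1 * ms
        + ((n : ℝ) / (((n : ℝ) + 2) * ((n : ℝ) + 1))) * ms ^ 2
        + τ ^ 2 * ((n : ℝ) / 2) *
            Real.log (((n : ℝ) + 1) * ((n : ℝ) - 1) / (((n : ℝ) + 2) * ((n : ℝ) - 2))))
    (hD : ∀ n : ℕ, 3 ≤ n → D n = Real.sqrt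
      (((n : ℝ) ^ 3 / ((n : ℝ) - 1) ^ 2) * β1 ^ 2 * ss ^ 2
        + (2 * (n : ℝ) ^ 2 / ((n : ℝ) - 1) ^ 2) * β1 * ms * ss ^ 2
        + ((n : ℝ) / (((n : ℝ) - 1) * ((n : ℝ) - 2))) * ms ^ 2 * ss ^ 2
        + ((n : ℝ) ^ 3 * (4 * (n : ℝ) ^ 3 + 9 * (n : ℝ) ^ 2 + 5 * (n : ℝ) - 6)
            / (2 * ((n : ℝ) + 2) ^ 2 * ((n : ℝ) + 1) ^ 2 * ((n : ℝ) - 1) * ((n : ℝ) - 2)))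
            * ss ^ 4)) :
    Tendsto (fun n => N n / D n) atTop (nhds 0) := by
  have hNlim : Tendsto N atTop (nhds (-β1 ^ 2)) := by
    have h := (((tendsto_sq_div_add_one_mul_sub_one.neg.mul_const (β1 ^ 2)).sub
      ((tendsto_two_mul_div_add_one_mul_sub_one.mul_const β1).mul_const ms)).add
      (tendsto_div_add_two_mul_add_one.mul_const (ms ^ 2))).add
      (tendsto_half_mul_log_ratio.const_mul (τ ^ 2))
    have hval : -1 * β1 ^ 2 - 0 * β1 * ms + 0 * ms ^ 2 + τ ^ 2 * 0 = -β1 ^ 2 := by ring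
    rw [hval] at h
    refine h.congr' ?_
    filter_upwards [eventually_ge_atTop 3] with n hn
    rw [hN n hn, mul_assoc (τ ^ 2)]
  have hDeq := (eventually_ge_atTop 3).mono hD
  have hrest := (((tendsto_two_mul_sq_div_sub_one_sq.mul_const β1).mul_const ms).mul_const
    (ss ^ 2)).add ((tendsto_div_sub_one_mul_sub_two.mul_const (ms ^ 2)).mul_const (ss ^ 2))
    |>.add (tendsto_residual_variance_coeff.mul_const (ss ^ 4))
  rcases eq_or_ne β1 0 with rfl | hβ
  · have hDlim : Tendsto D atTop (nhds (Real.sqrt (2 * ss ^ 4))) := by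
      have hval : 2 * 0 * ms * ss ^ 2 + 0 * ms ^ 2 * ss ^ 2 + 2 * ss ^ 4 = 2 * ss ^ 4 := by ring
      rw [hval] at hrest
      refine hrest.sqrt.congr' ?_
      filter_upwards [hDeq] with n hn
      rw [hn]
      congr 1
      ring
    have hpos : Real.sqrt (2 * ss ^ 4) ≠ 0 := (Real.sqrt_pos.2 (by positivity)).ne'
    have hratio : Tendsto (fun n => N n / D n) atTop
        (nhds (-0 ^ 2 / Real.sqrt (2 * ss ^ 4))) := hNlim.div hDlim hpos
    simpa using hratio
  · have hDlim : Tendsto D atTop atTop := by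
      have hlead := (tendsto_cube_div_sub_one_sq.atTop_mul_const
        (show 0 < β1 ^ 2 by positivity)).atTop_mul_const (show 0 < ss ^ 2 by positivity)
      refine (Real.tendsto_sqrt_atTop.comp (hlead.atTop_add hrest)).congr' ?_
      filter_upwards [hDeq] with n hn
      rw [hn, Function.comp_apply]
      congr 1
      ring
    exact hNlim.div_atTop hDlim
end
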